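/- Let 𝒜 : H^s(S^{d−1}) → H^{−s}(S^{d−1}) be a bounded linear operator and set a_{mjnk} := ⟨𝒜 Y_{mj}, Y_{nk}⟩. If s ≥ d/2, then the operator norm satisfies ‖𝒜‖_{s→−s} ≤ 4√2 · sup_{m,j,n,k} (1 + max{m, n})^{d/2 − s} |a_{mjnk}|. -/

import Mathlib

/-!
STATEMENT 4: Matrix representation bound for a bounded operator
`𝒜 : H^s(S^{d-1}) → H^{-s}(S^{d-1})`.

The Sobolev spaces `H^s(S^{d-1})` and `H^{-s}(S^{d-1})` are given abstractly as normed
spaces `Hs`, `Hms`, together with: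
* the family `Y` of spherical harmonics, indexed by `(m, j)` with `1 ≤ j ≤ p m`,
  where `p m = C(m+d-1, d-1) - C(m+d-3, d-1)` is the dimension of the space of degree-`m`
  spherical harmonics;
* the coefficient functionals `coef (m,j) φ = a_{mj}` of the expansion `φ = Σ a_{mj} Y_{mj}`
  (hypotheses `hbasis`, `hcoef`);
* the `L²(S^{d-1})` duality pairing `pair : H^{-s} → H^s → ℂ`, so that
  `a_{mjnk} = pair (𝒜 Y_{mj}) Y_{nk} = ⟨𝒜 Y_{mj}, Y_{nk}⟩`;
* the norm characterizations `‖φ‖²_{H^s} = Σ (1+m)^{2s} |a_{mj}|²` and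
  `‖u‖²_{H^{-s}} = Σ (1+m)^{-2s} |⟨u, Y_{mj}⟩|²`.

The conclusion `‖𝒜‖_{s→-s} ≤ 4√2 ‖(a_{mjnk})‖_{X_s}` is stated as: for every upper bound
`K` of the family `(1+max{m,n})^{d/2-s} |a_{mjnk}|`, one has `‖𝒜‖ ≤ 4√2 K`.
-/
/-- The elementary bound `C(m + e, e) ≤ (m + 1) ^ e`. -/
lemma choose_add_le_succ_pow (m e : ℕ) : (m + e).choose e ≤ (m + 1) ^ e := by
  induction e with
  | zero => simp
  | succ e ih =>
    have h := Nat.add_one_mul_choose_eq (m + e) e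
    have h2 : m + e + 1 ≤ (m + 1) * (e + 1) := by nlinarith [Nat.zero_le (m * e)]
    have h3 : (m + e + 1).choose (e + 1) * (e + 1) ≤ (m + 1) ^ (e + 1) * (e + 1) := by
      rw [← h, pow_succ]
      calc (m + e + 1) * (m + e).choose e
          ≤ ((m + 1) * (e + 1)) * (m + 1) ^ e := Nat.mul_le_mul h2 ih
        _ = (m + 1) ^ e * (m + 1) * (e + 1) := by ring
    exact Nat.le_of_mul_le_mul_right h3 (Nat.succ_pos e)

/-- The dimension of the space of degree-`m` spherical harmonics on `S^{e+1}` is at most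
`2 (m + 1) ^ e`. -/
lemma choose_sub_choose_le (m e : ℕ) :
    (m + (e + 2) - 1).choose (e + 2 - 1) - (m + (e + 2) - 3).choose (e + 2 - 1)
      ≤ 2 * (m + 1) ^ e := by
  rcases m with _ | m
  · have h : (0 + (e + 2) - 1).choose (e + 2 - 1) = 1 := by simp
    rw [h, zero_add 1, one_pow]
    omega
  · have e1 : m + 1 + (e + 2) - 1 = (m + e) + 1 + 1 := by omega
    have e2 : m + 1 + (e + 2) - 3 = m + e := by omega
    have e3 : e + 2 - 1 = e + 1 := by omega
    rw [e1, e2, e3, Nat.choose_succ_succ (m + e + 1) e, Nat.choose_succ_succ (m + e) e]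
    have h := choose_add_le_succ_pow (m + 1) e
    rw [show m + 1 + e = m + e + 1 by ring] at h
    have h2 : (m + e).choose e ≤ (m + e + 1).choose e := Nat.choose_le_choose e (Nat.le_succ _)
    simp only [Nat.succ_eq_add_one]
    omega

lemma sum_range_inv_succ_sq_le_two (N : ℕ) :
    ∑ m ∈ Finset.range N, (((1 + m : ℕ) : ℝ) ^ 2)⁻¹ ≤ 2 := by
  suffices h : ∑ m ∈ Finset.range N, (((1 + m : ℕ) : ℝ) ^ 2)⁻¹ ≤ 2 - (N : ℝ)⁻¹ by
    have : (0 : ℝ) ≤ (N : ℝ)⁻¹ := by positivity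
    linarith
  induction N with
  | zero => simp
  | succ N ih =>
    rw [Finset.sum_range_succ]
    rcases Nat.eq_zero_or_pos N with rfl | hN
    · norm_num
    · have hN' : (0 : ℝ) < N := by exact_mod_cast hN
      have h : (((1 + N : ℕ) : ℝ) ^ 2)⁻¹ ≤ (N : ℝ)⁻¹ - ((N + 1 : ℕ) : ℝ)⁻¹ := by
        push_cast
        rw [inv_sub_inv hN'.ne' (by positivity), inv_eq_one_div,
          div_le_div_iff₀ (by positivity) (by positivity)]
        nlinarith
      linarith

/-- If `p m ≤ 2 (m + 1) ^ (d - 2)`, then `∑ (1 + m) ^ (-d)` over pairs `(m, j)` with `j < p m`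
has all its finite partial sums at most `4`. -/
lemma sum_sigma_rpow_neg_le_four (d : ℕ) (hd : 2 ≤ d) (p : ℕ → ℕ)
    (hp : ∀ m, p m ≤ 2 * (m + 1) ^ (d - 2)) (F : Finset (Σ m : ℕ, Fin (p m))) :
    ∑ i ∈ F, ((1 + i.1 : ℕ) : ℝ) ^ (-(d : ℝ)) ≤ 4 := by
  set N := F.sup (fun i => i.1) + 1
  have hsub : F ⊆ (Finset.range N).sigma (fun _ => Finset.univ) := by
    intro i hi
    have : i.1 ≤ F.sup (fun i => i.1) := Finset.le_sup (f := fun i => i.1) hi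
    simp only [Finset.mem_sigma, Finset.mem_range, Finset.mem_univ, and_true]
    omega
  have hterm (m : ℕ) :
      (p m : ℝ) * ((1 + m : ℕ) : ℝ) ^ (-(d : ℝ)) ≤ 2 * (((1 + m : ℕ) : ℝ) ^ 2)⁻¹ := by
    have hpos : (0 : ℝ) < ((1 + m : ℕ) : ℝ) := by positivity
    have hpm : (p m : ℝ) ≤ 2 * ((1 + m : ℕ) : ℝ) ^ (d - 2) := by
      have := hp m
      rw [add_comm m 1] at this
      exact_mod_cast this
    rw [Real.rpow_neg hpos.le, Real.rpow_natCast]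
    calc (p m : ℝ) * (((1 + m : ℕ) : ℝ) ^ d)⁻¹
        ≤ 2 * ((1 + m : ℕ) : ℝ) ^ (d - 2) * (((1 + m : ℕ) : ℝ) ^ d)⁻¹ := by gcongr
      _ = 2 * (((1 + m : ℕ) : ℝ) ^ 2)⁻¹ := by
        obtain ⟨e, rfl⟩ := Nat.exists_eq_add_of_le hd
        rw [Nat.add_sub_cancel_left, pow_add]
        field_simp
  calc ∑ i ∈ F, ((1 + i.1 : ℕ) : ℝ) ^ (-(d : ℝ))
      ≤ ∑ i ∈ (Finset.range N).sigma (fun m => (Finset.univ : Finset (Fin (p m)))),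
          ((1 + i.1 : ℕ) : ℝ) ^ (-(d : ℝ)) :=
        Finset.sum_le_sum_of_subset_of_nonneg hsub fun i _ _ => by positivity
    _ = ∑ m ∈ Finset.range N, (p m : ℝ) * ((1 + m : ℕ) : ℝ) ^ (-(d : ℝ)) := by
        rw [Finset.sum_sigma]
        simp
    _ ≤ ∑ m ∈ Finset.range N, 2 * (((1 + m : ℕ) : ℝ) ^ 2)⁻¹ :=
        Finset.sum_le_sum fun m _ => hterm m
    _ ≤ 4 := by
        rw [← Finset.mul_sum]
        linarith [sum_range_inv_succ_sq_le_two N]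

/-- For `d ≤ 2 s`, the weights satisfy
`x^{-2s} y^{-2s} max(x, y)^{2s-d} ≤ x^{-d} y^{-d}` when `x, y ≥ 1`. -/
lemma rpow_neg_mul_rpow_neg_mul_max_rpow_le {x y d s : ℝ} (hx : 1 ≤ x) (hy : 1 ≤ y)
    (hs : d / 2 ≤ s) :
    x ^ (-(2 * s)) * (y ^ (-(2 * s)) * max x y ^ (2 * s - d)) ≤ x ^ (-d) * y ^ (-d) := by
  wlog hxy : x ≤ y generalizing x y
  · have h := this hy hx (le_of_not_ge hxy)
    rw [max_comm y x] at h
    linarith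
  rw [max_eq_right hxy, ← Real.rpow_add (by linarith),
    show -(2 * s) + (2 * s - d) = -d by ring]
  gcongr
  linarith

theorem statement4 (d : ℕ) (hd : 2 ≤ d) (s : ℝ) (hs : (d : ℝ) / 2 ≤ s)
    (p : ℕ → ℕ)
    (hp : ∀ m, p m = Nat.choose (m + d - 1) (d - 1) - Nat.choose (m + d - 3) (d - 1))
    (Hs Hms : Type*) [NormedAddCommGroup Hs] [NormedSpace ℂ Hs]
    [NormedAddCommGroup Hms] [NormedSpace ℂ Hms]
    (A : Hs →L[ℂ] Hms)
    (Y : (Σ m : ℕ, Fin (p m)) → Hs)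
    (coef : (Σ m : ℕ, Fin (p m)) → Hs → ℂ)
    (pair : Hms → Hs → ℂ)
    (hbasis : ∀ φ : Hs, HasSum (fun i => coef i φ • Y i) φ)
    (hcoef : ∀ i i', coef i (Y i') = if i = i' then 1 else 0)
    (hHs : ∀ φ : Hs, ‖φ‖ ^ 2 = ∑' i : (Σ m : ℕ, Fin (p m)),
      ((1 + i.1 : ℕ) : ℝ) ^ (2 * s) * ‖coef i φ‖ ^ 2)
    (hHms : ∀ u : Hms, ‖u‖ ^ 2 = ∑' i : (Σ m : ℕ, Fin (p m)),
      ((1 + i.1 : ℕ) : ℝ) ^ (-(2 * s)) * ‖pair u (Y i)‖ ^ 2) :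
    ∀ K : ℝ,
      (∀ i j : (Σ m : ℕ, Fin (p m)),
        ((1 + max i.1 j.1 : ℕ) : ℝ) ^ ((d : ℝ) / 2 - s) * ‖pair (A (Y i)) (Y j)‖ ≤ K) →
      ‖A‖ ≤ 4 * Real.sqrt 2 * K := by
  intro K hK
  set g : (Σ m : ℕ, Fin (p m)) → ℝ := fun i => ((1 + i.1 : ℕ) : ℝ) ^ (-(d : ℝ))
  have hp' : ∀ m, p m ≤ 2 * (m + 1) ^ (d - 2) := by
    intro m
    obtain ⟨e, rfl⟩ := Nat.exists_eq_add_of_le' hd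
    rw [hp m]
    exact choose_sub_choose_le m e
  have hg0 : ∀ i, 0 ≤ g i := fun i => by positivity
  have hgF : ∀ F : Finset (Σ m : ℕ, Fin (p m)), ∑ i ∈ F, g i ≤ 4 :=
    sum_sigma_rpow_neg_le_four d hd p hp'
  have hgs : Summable g := summable_of_sum_le hg0 hgF
  have hgt : ∑' i, g i ≤ 4 := hgs.tsum_le_of_sum_le hgF
  have hp0 : 0 < p 0 := by
    rw [hp 0, zero_add, Nat.choose_self,
      Nat.choose_eq_zero_of_lt (show d - 3 < d - 1 by omega)]
    norm_num
  have hK0 : 0 ≤ K := le_trans (by positivity) (hK ⟨0, ⟨0, hp0⟩⟩ ⟨0, ⟨0, hp0⟩⟩)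
  have hent (i j : Σ m : ℕ, Fin (p m)) :
      ((1 + i.1 : ℕ) : ℝ) ^ (-(2 * s)) *
        (((1 + j.1 : ℕ) : ℝ) ^ (-(2 * s)) * ‖pair (A (Y i)) (Y j)‖ ^ 2)
      ≤ K ^ 2 * g i * g j := by
    have hmax : ((1 + max i.1 j.1 : ℕ) : ℝ) = max ((1 + i.1 : ℕ) : ℝ) ((1 + j.1 : ℕ) : ℝ) := by
      rw [← Nat.cast_max, Nat.add_max_add_left]
    have hM : (0 : ℝ) < ((1 + max i.1 j.1 : ℕ) : ℝ) := by positivity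
    have hsq : ‖pair (A (Y i)) (Y j)‖ ^ 2
        ≤ ((1 + max i.1 j.1 : ℕ) : ℝ) ^ (2 * s - d) * K ^ 2 := by
      have h1 : ‖pair (A (Y i)) (Y j)‖ ≤ ((1 + max i.1 j.1 : ℕ) : ℝ) ^ (s - d / 2) * K := by
        have h2 := mul_le_mul_of_nonneg_left (hK i j)
          (Real.rpow_nonneg hM.le (s - (d : ℝ) / 2))
        rwa [← mul_assoc, ← Real.rpow_add hM,
          show s - (d : ℝ) / 2 + ((d : ℝ) / 2 - s) = 0 by ring, Real.rpow_zero, one_mul] at h2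
      calc ‖pair (A (Y i)) (Y j)‖ ^ 2
          ≤ (((1 + max i.1 j.1 : ℕ) : ℝ) ^ (s - d / 2) * K) ^ 2 := by gcongr
        _ = ((1 + max i.1 j.1 : ℕ) : ℝ) ^ (2 * s - d) * K ^ 2 := by
          rw [mul_pow, pow_two (_ ^ (s - (d : ℝ) / 2)), ← Real.rpow_add hM]
          ring_nf
    have hw := rpow_neg_mul_rpow_neg_mul_max_rpow_le
      (x := ((1 + i.1 : ℕ) : ℝ)) (y := ((1 + j.1 : ℕ) : ℝ))
      (by exact_mod_cast Nat.le_add_right 1 _) (by exact_mod_cast Nat.le_add_right 1 _) hs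
    rw [← hmax] at hw
    calc _ ≤ ((1 + i.1 : ℕ) : ℝ) ^ (-(2 * s)) * (((1 + j.1 : ℕ) : ℝ) ^ (-(2 * s)) *
            (((1 + max i.1 j.1 : ℕ) : ℝ) ^ (2 * s - d) * K ^ 2)) := by gcongr
      _ = (((1 + i.1 : ℕ) : ℝ) ^ (-(2 * s)) * (((1 + j.1 : ℕ) : ℝ) ^ (-(2 * s)) *
            ((1 + max i.1 j.1 : ℕ) : ℝ) ^ (2 * s - d))) * K ^ 2 := by ring
      _ ≤ (g i * g j) * K ^ 2 := by gcongr
      _ = K ^ 2 * g i * g j := by ring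
  have hcol (i : Σ m : ℕ, Fin (p m)) :
      ((1 + i.1 : ℕ) : ℝ) ^ (-(2 * s)) * ‖A (Y i)‖ ^ 2 ≤ 4 * K ^ 2 * g i := by
    rw [hHms, ← tsum_mul_left]
    have hsum : Summable fun j => K ^ 2 * g i * g j := hgs.mul_left _
    calc _ ≤ ∑' j, K ^ 2 * g i * g j :=
          (hsum.of_nonneg_of_le (fun j => by positivity) (hent i)).tsum_le_tsum (hent i) hsum
      _ = K ^ 2 * g i * ∑' j, g j := tsum_mul_left
      _ ≤ K ^ 2 * g i * 4 := mul_le_mul_of_nonneg_left hgt (mul_nonneg (sq_nonneg K) (hg0 i))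
      _ = 4 * K ^ 2 * g i := by ring
  have hA : ‖A‖ ≤ 4 * K := by
    refine A.opNorm_le_bound (by positivity) fun φ => ?_
    by_cases hφ : Summable fun i : (Σ m : ℕ, Fin (p m)) =>
        ((1 + i.1 : ℕ) : ℝ) ^ (2 * s) * ‖coef i φ‖ ^ 2
    · have hlim : HasSum (fun i => A (coef i φ • Y i)) (A φ) := A.hasSum (hbasis φ)
      refine le_of_tendsto hlim.norm (Filter.Eventually.of_forall fun F => ?_)
      have hcs := Finset.sum_mul_sq_le_sq_mul_sq F
        (fun i => ((1 + i.1 : ℕ) : ℝ) ^ s * ‖coef i φ‖)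
        (fun i => ((1 + i.1 : ℕ) : ℝ) ^ (-s) * ‖A (Y i)‖)
      have hl : ∑ i ∈ F, (((1 + i.1 : ℕ) : ℝ) ^ s * ‖coef i φ‖) ^ 2 ≤ ‖φ‖ ^ 2 := by
        rw [hHs φ]
        refine le_trans (le_of_eq (Finset.sum_congr rfl fun i _ => ?_))
          (hφ.sum_le_tsum F fun i _ => by positivity)
        rw [mul_pow, pow_two (_ ^ s), ← Real.rpow_add (by positivity), two_mul]
      have hr : ∑ i ∈ F, (((1 + i.1 : ℕ) : ℝ) ^ (-s) * ‖A (Y i)‖) ^ 2 ≤ (4 * K) ^ 2 := by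
        calc _ ≤ ∑ i ∈ F, 4 * K ^ 2 * g i := by
              refine Finset.sum_le_sum fun i _ => le_trans (le_of_eq ?_) (hcol i)
              rw [mul_pow, pow_two (_ ^ (-s)), ← Real.rpow_add (by positivity), two_mul, neg_add]
          _ = 4 * K ^ 2 * ∑ i ∈ F, g i := by rw [Finset.mul_sum]
          _ ≤ 4 * K ^ 2 * 4 := by gcongr; exact hgF F
          _ = (4 * K) ^ 2 := by ring
      calc ‖∑ i ∈ F, A (coef i φ • Y i)‖
          ≤ ∑ i ∈ F, ‖A (coef i φ • Y i)‖ := norm_sum_le _ _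
        _ = ∑ i ∈ F, (((1 + i.1 : ℕ) : ℝ) ^ s * ‖coef i φ‖) *
              (((1 + i.1 : ℕ) : ℝ) ^ (-s) * ‖A (Y i)‖) := by
            refine Finset.sum_congr rfl fun i _ => ?_
            have h1 : ((1 + i.1 : ℕ) : ℝ) ^ s * ((1 + i.1 : ℕ) : ℝ) ^ (-s) = 1 := by
              rw [← Real.rpow_add (by positivity), add_neg_cancel, Real.rpow_zero]
            rw [map_smul, norm_smul, mul_mul_mul_comm, h1, one_mul]
        _ ≤ 4 * K * ‖φ‖ := by
            refine abs_le_of_sq_le_sq' ?_ (by positivity) |>.2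
            calc _ ≤ _ := hcs
              _ ≤ ‖φ‖ ^ 2 * (4 * K) ^ 2 := by gcongr
              _ = (4 * K * ‖φ‖) ^ 2 := by ring
    · have h0 : ‖φ‖ ^ 2 = 0 := by rw [hHs φ, tsum_eq_zero_of_not_summable hφ]
      have : φ = 0 := by simpa using h0
      simp [this]
  have h2 : (1 : ℝ) ≤ Real.sqrt 2 := by
    rw [Real.one_le_sqrt]
    norm_num
  nlinarith
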